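/- arXiv:2010.09513 — 2 statements merged into one kernel-verified Lean document; each statement's English description precedes it below -/
import Mathlib

section
/- For every n ≥ 1, the ascent-plateau polynomial M_n(x), a polynomial of degree n−1, is alternatingly increasing; consequently M_n(x) is unimodal with mode ⌊n/2⌋. -/
open Polynomial Finset

/-- A candidate Stirling permutation of order `n`: a word of length `2n` with
letters in `[n]` (encoded as `Fin n`). -/
abbrev StWord (n : ℕ) := Fin (2 * n) → Fin n

/-- The letter of a word at position `i ∈ [2n]` (1-indexed, values in `[n]`),
with the convention that the value is `0` outside `[1, 2n]` (so `σ_0 = 0`). -/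
def qval (n : ℕ) (σ : StWord n) (i : ℕ) : ℕ :=
  if h : 1 ≤ i ∧ i ≤ 2 * n then (σ ⟨i - 1, by omega⟩ : Fin n).val + 1 else 0

/-- `σ` is a Stirling permutation: each letter of `[n]` occurs exactly twice,
and all entries between the two occurrences of any letter are larger than it. -/
def IsStirling (n : ℕ) (σ : StWord n) : Prop :=
  (∀ k : Fin n, (Finset.univ.filter (fun i => σ i = k)).card = 2) ∧
  (∀ a b c : Fin (2 * n), a < b → b < c → σ a = σ c → σ a < σ b)

instance (n : ℕ) : DecidablePred (IsStirling n) := fun σ => by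
  unfold IsStirling; infer_instance

/-- The ascent-plateau number `ap(σ) = #{i ∈ [2, 2n-1] : σ_{i-1} < σ_i = σ_{i+1}}`. -/
def ap (n : ℕ) (σ : StWord n) : ℕ :=
  ((Finset.Icc 2 (2 * n - 1)).filter
    (fun i => qval n σ (i - 1) < qval n σ i ∧ qval n σ i = qval n σ (i + 1))).card

/-- The left ascent-plateau number
`lap(σ) = #{i ∈ [2n-1] : σ_{i-1} < σ_i = σ_{i+1}}` with `σ_0 = 0`. -/
def lap (n : ℕ) (σ : StWord n) : ℕ :=
  ((Finset.Icc 1 (2 * n - 1)).filter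
    (fun i => qval n σ (i - 1) < qval n σ i ∧ qval n σ i = qval n σ (i + 1))).card

/-- `L_n^E(x) = Σ_{σ ∈ Q_n, σ_1 < σ_2} x^{ap(σ)}`. -/
noncomputable def LEpoly (n : ℕ) : Polynomial ℝ :=
  ∑ σ ∈ Finset.univ.filter
      (fun σ : StWord n => IsStirling n σ ∧ qval n σ 1 < qval n σ 2),
    X ^ ap n σ

/-- `L_n^O(x) = Σ_{σ ∈ Q_n, σ_1 = σ_2} x^{ap(σ)}`. -/
noncomputable def LOpoly (n : ℕ) : Polynomial ℝ :=
  ∑ σ ∈ Finset.univ.filter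
      (fun σ : StWord n => IsStirling n σ ∧ qval n σ 1 = qval n σ 2),
    X ^ ap n σ

/-- The ascent-plateau polynomial `M_n(x) = Σ_{σ ∈ Q_n} x^{ap(σ)}`. -/
noncomputable def Mpoly (n : ℕ) : Polynomial ℝ :=
  ∑ σ ∈ Finset.univ.filter (fun σ : StWord n => IsStirling n σ), X ^ ap n σ

/-- The order embedding of the positions of a word into those of the longer word which has two
additional letters at the positions `j` and `j + 1`. -/
def gapShift {n : ℕ} (j : Fin (2 * n + 1)) (i : Fin (2 * n)) : Fin (2 * (n + 1)) :=
  ⟨if i.val < j.val then i.val else i.val + 2, by split_ifs <;> omega⟩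

lemma gapShift_strictMono {n : ℕ} (j : Fin (2 * n + 1)) : StrictMono (gapShift j) := by
  intro a b hab
  simp only [gapShift, Fin.lt_def] at *
  split_ifs <;> omega

lemma gapShift_cases {n : ℕ} (j : Fin (2 * n + 1)) (i : Fin (2 * (n + 1))) :
    (i.val = j.val ∨ i.val = j.val + 1) ∨ ∃ i₀, i = gapShift j i₀ := by
  by_cases h1 : i.val < j.val
  · exact .inr ⟨⟨i.val, by omega⟩, by simp [gapShift, h1]⟩
  · by_cases h2 : i.val < j.val + 2
    · left; omega
    · refine .inr ⟨⟨i.val - 2, by omega⟩, ?_⟩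
      ext
      simp only [gapShift]
      split_ifs <;> omega

/-- Insertion of two adjacent copies of the new largest letter after the first `j` letters. -/
def insertMax {n : ℕ} (σ : StWord n) (j : Fin (2 * n + 1)) : StWord (n + 1) := fun i =>
  if h : i.val < j.val then (σ ⟨i.val, by omega⟩).castSucc
  else if h' : i.val < j.val + 2 then Fin.last n
  else (σ ⟨i.val - 2, by omega⟩).castSucc

lemma insertMax_gapShift {n : ℕ} (σ : StWord n) (j : Fin (2 * n + 1)) (i : Fin (2 * n)) :
    insertMax σ j (gapShift j i) = (σ i).castSucc := by
  by_cases h : i.val < j.val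
  · simp [insertMax, gapShift, h]
  · have h1 : ¬ i.val + 2 < j.val := by omega
    simp [insertMax, gapShift, h, h1]

lemma insertMax_eq_last_iff {n : ℕ} (σ : StWord n) (j : Fin (2 * n + 1)) (i : Fin (2 * (n + 1))) :
    insertMax σ j i = Fin.last n ↔ i.val = j.val ∨ i.val = j.val + 1 := by
  unfold insertMax
  split_ifs with h h'
  · simp only [Fin.castSucc_ne_last, false_iff]; omega
  · simp only [true_iff]; omega
  · simp only [Fin.castSucc_ne_last, false_iff]; omega

lemma qval_insertMax {n : ℕ} (σ : StWord n) (j : Fin (2 * n + 1)) (i : ℕ) :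
    qval (n + 1) (insertMax σ j) i =
      if i ≤ j.val then qval n σ i else if i ≤ j.val + 2 then n + 1 else qval n σ (i - 2) := by
  have hj := j.isLt
  unfold qval insertMax
  split_ifs <;> grind

lemma qval_le {n : ℕ} (σ : StWord n) (i : ℕ) : qval n σ i ≤ n := by
  unfold qval
  split_ifs <;> omega

/-- The set of ascent-plateaus of a word. -/
def ascentPlateaus (n : ℕ) (σ : StWord n) : Finset ℕ :=
  (Finset.Icc 2 (2 * n - 1)).filter
    (fun i => qval n σ (i - 1) < qval n σ i ∧ qval n σ i = qval n σ (i + 1))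

lemma mem_ascentPlateaus {n : ℕ} {σ : StWord n} {i : ℕ} :
    i ∈ ascentPlateaus n σ ↔ (2 ≤ i ∧ i ≤ 2 * n - 1) ∧
      qval n σ (i - 1) < qval n σ i ∧ qval n σ i = qval n σ (i + 1) := by
  simp [ascentPlateaus]

lemma ascentPlateaus_insertMax {n : ℕ} (σ : StWord n) (j : Fin (2 * n + 1)) :
    ascentPlateaus (n + 1) (insertMax σ j) =
      ((ascentPlateaus n σ).filter (· < j.val) ∪
        ((ascentPlateaus n σ).filter (j.val + 1 < ·)).image (· + 2)) ∪
      (if j.val = 0 then ∅ else {j.val + 1}) := by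
  have hj := j.isLt
  ext i
  have hmem : i ∈ (if j.val = 0 then (∅ : Finset ℕ) else {j.val + 1}) ↔
      j.val ≠ 0 ∧ i = j.val + 1 := by split_ifs with h <;> simp [h]
  simp only [mem_union, hmem, mem_filter, mem_image]
  have himg : (∃ a, (a ∈ ascentPlateaus n σ ∧ j.val + 1 < a) ∧ a + 2 = i) ↔
      j.val + 3 < i ∧ i - 2 ∈ ascentPlateaus n σ := by
    constructor
    · rintro ⟨a, ⟨h1, h2⟩, rfl⟩
      exact ⟨by omega, by simpa using h1⟩
    · rintro ⟨h1, h2⟩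
      exact ⟨i - 2, ⟨h2, by omega⟩, by omega⟩
  rw [himg]
  simp only [mem_ascentPlateaus, qval_insertMax]
  have hq := qval_le σ
  have h1 := hq i
  have h2 := hq (i - 1)
  have h3 := hq (i - 2)
  rcases lt_trichotomy i j.val with h | h | h
  · rw [if_pos (by omega), if_pos (by omega), if_pos (by omega)]
    constructor
    · rintro ⟨ha, hb⟩
      exact .inl (.inl ⟨⟨⟨by omega, by omega⟩, hb⟩, h⟩)
    · rintro ((⟨⟨ha, hb⟩, -⟩ | ⟨ha, -⟩) | ⟨-, ha⟩)
      · exact ⟨by omega, hb⟩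
      · omega
      · omega
  · rw [if_pos (by omega), if_pos (by omega), if_neg (by omega), if_pos (by omega)]
    omega
  · by_cases h4 : i ≤ j.val + 3
    · rw [if_neg (by omega : ¬ i ≤ j.val), if_neg (by omega : ¬ i + 1 ≤ j.val)]
      split_ifs <;> omega
    · rw [if_neg (by omega), if_neg (by omega), if_neg (by omega), if_neg (by omega),
        if_neg (by omega), if_neg (by omega), show i - 1 - 2 = i - 2 - 1 by omega,
        show i + 1 - 2 = i - 2 + 1 by omega]
      omega

lemma succ_notMem_ascentPlateaus {n : ℕ} {σ : StWord n} {i : ℕ} (hi : i ∈ ascentPlateaus n σ) :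
    i + 1 ∉ ascentPlateaus n σ := by
  rw [mem_ascentPlateaus] at *
  simp only [Nat.add_sub_cancel]
  omega

/-- The gaps of a word where inserting two copies of a new largest letter does not change the
number of ascent-plateaus. -/
def neutralGaps (n : ℕ) (σ : StWord n) : Finset ℕ :=
  insert 0 (ascentPlateaus n σ ∪ (ascentPlateaus n σ).image (· - 1))

lemma mem_neutralGaps {n : ℕ} {σ : StWord n} {j : ℕ} :
    j ∈ neutralGaps n σ ↔ j = 0 ∨ j ∈ ascentPlateaus n σ ∨ j + 1 ∈ ascentPlateaus n σ := by
  simp only [neutralGaps, mem_insert, mem_union, mem_image]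
  constructor
  · rintro (h | h | ⟨a, h, rfl⟩)
    · exact .inl h
    · exact .inr (.inl h)
    · have := (mem_ascentPlateaus.1 h).1
      rw [show a - 1 + 1 = a by omega]
      exact .inr (.inr h)
  · rintro (h | h | h)
    · exact .inl h
    · exact .inr (.inl h)
    · exact .inr (.inr ⟨j + 1, h, by omega⟩)

lemma card_neutralGaps (n : ℕ) (σ : StWord n) : (neutralGaps n σ).card = 2 * ap n σ + 1 := by
  have hap : (ascentPlateaus n σ).card = ap n σ := rfl
  rw [neutralGaps, card_insert_of_notMem, card_union_of_disjoint, card_image_of_injOn, hap]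
  · ring
  · intro a ha b hb hab
    have h1 := (mem_ascentPlateaus.1 ha).1
    have h2 := (mem_ascentPlateaus.1 hb).1
    simp only at hab
    omega
  · rw [disjoint_left]
    intro a ha hb
    obtain ⟨b, hb', rfl⟩ := mem_image.1 hb
    have h2 := (mem_ascentPlateaus.1 hb').1
    apply succ_notMem_ascentPlateaus ha
    rwa [show b - 1 + 1 = b by omega]
  · simp only [mem_union, mem_image, not_or, not_exists, not_and]
    refine ⟨fun h => ?_, fun a h => ?_⟩
    · have := (mem_ascentPlateaus.1 h).1
      omega
    · have := (mem_ascentPlateaus.1 h).1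
      omega

lemma neutralGaps_subset (n : ℕ) (σ : StWord n) : neutralGaps n σ ⊆ range (2 * n + 1) := by
  intro j hj
  rw [mem_range]
  rcases mem_neutralGaps.1 hj with h | h | h
  · omega
  · have := (mem_ascentPlateaus.1 h).1
    omega
  · have := (mem_ascentPlateaus.1 h).1
    omega

lemma ap_insertMax {n : ℕ} (σ : StWord n) (j : Fin (2 * n + 1)) :
    ap (n + 1) (insertMax σ j) = ap n σ + if j.val ∈ neutralGaps n σ then 0 else 1 := by
  set P := ascentPlateaus n σ with hP
  have hsplit : P.card = (P.filter (· < j.val)).card + (P.filter (j.val + 1 < ·)).card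
      + ((if j.val ∈ P then 1 else 0) + if j.val + 1 ∈ P then 1 else 0) := by
    rw [card_eq_sum_ones, card_filter, card_filter, ← Finset.sum_ite_eq' P j.val (fun _ => 1),
      ← Finset.sum_ite_eq' P (j.val + 1) (fun _ => 1), ← sum_add_distrib, ← sum_add_distrib,
      ← sum_add_distrib]
    refine sum_congr rfl fun i _ => ?_
    split_ifs <;> omega
  change (ascentPlateaus (n + 1) (insertMax σ j)).card = P.card + _
  rw [ascentPlateaus_insertMax, card_union_of_disjoint, card_union_of_disjoint,
    card_image_of_injective _ (add_left_injective 2), ← hP, hsplit]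
  · have h0 : 0 ∉ P := fun h => by have := (mem_ascentPlateaus.1 h).1; omega
    have h1 : 1 ∉ P := fun h => by have := (mem_ascentPlateaus.1 h).1; omega
    have h2 : j.val ∈ P → j.val + 1 ∉ P := succ_notMem_ascentPlateaus
    simp only [mem_neutralGaps, ← hP]
    by_cases hj : j.val = 0
    · simp [hj, h0, h1]
    · by_cases ha : j.val ∈ P
      · simp [hj, ha, h2 ha]
      · by_cases hb : j.val + 1 ∈ P <;> simp [hj, ha, hb]
  · rw [disjoint_left]
    intro a ha hb
    obtain ⟨b, hb', rfl⟩ := mem_image.1 hb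
    simp only [mem_filter] at ha hb'
    omega
  · rw [disjoint_left]
    intro a ha hb
    have hb : a = j.val + 1 := by
      split_ifs at hb
      · simp at hb
      · simpa using hb
    simp only [mem_union, mem_filter, mem_image] at ha
    rcases ha with ha | ⟨b, hb, rfl⟩ <;> omega

lemma sum_pow_ap_insertMax {n : ℕ} (σ : StWord n) :
    ∑ j : Fin (2 * n + 1), (X : ℝ[X]) ^ ap (n + 1) (insertMax σ j) =
      C (2 * (ap n σ : ℝ) + 1) * X ^ ap n σ
        + C (2 * (n : ℝ) - 2 * (ap n σ : ℝ)) * X ^ (ap n σ + 1) := by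
  have h1 : ∀ j : Fin (2 * n + 1), (X : ℝ[X]) ^ ap (n + 1) (insertMax σ j) =
      if j.val ∈ neutralGaps n σ then X ^ ap n σ else X ^ (ap n σ + 1) := by
    intro j
    rw [ap_insertMax]
    split_ifs <;> rfl
  rw [Fintype.sum_congr _ _ h1,
    Fin.sum_univ_eq_sum_range (fun j => if j ∈ neutralGaps n σ then (X : ℝ[X]) ^ ap n σ
      else X ^ (ap n σ + 1)), sum_ite, sum_const, sum_const]
  have h2 : (range (2 * n + 1)).filter (· ∈ neutralGaps n σ) = neutralGaps n σ := by
    rw [filter_mem_eq_inter]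
    exact inter_eq_right.2 (neutralGaps_subset n σ)
  have h3 := card_filter_add_card_filter_not (s := range (2 * n + 1)) (· ∈ neutralGaps n σ)
  rw [h2, card_neutralGaps, card_range] at h3
  have h4 : (((range (2 * n + 1)).filter (· ∉ neutralGaps n σ)).card : ℝ)
      = 2 * (n : ℝ) - 2 * (ap n σ : ℝ) := by
    rw [eq_sub_iff_add_eq]
    norm_cast
    omega
  rw [h2, card_neutralGaps, nsmul_eq_mul, nsmul_eq_mul, ← h4]
  simp [map_ofNat (C : ℝ →+* ℝ[X]) 2]

lemma card_filter_insertMax_castSucc {n : ℕ} (σ : StWord n) (j : Fin (2 * n + 1)) (k : Fin n) :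
    (univ.filter fun i => insertMax σ j i = k.castSucc).card =
      (univ.filter fun i => σ i = k).card := by
  rw [← card_image_of_injective _ (gapShift_strictMono j).injective]
  congr 1
  ext i
  simp only [mem_filter, mem_univ, true_and, mem_image]
  constructor
  · intro h
    rcases gapShift_cases j i with h' | ⟨i₀, rfl⟩
    · rw [(insertMax_eq_last_iff σ j i).2 h'] at h
      exact absurd h.symm (Fin.castSucc_ne_last k)
    · rw [insertMax_gapShift] at h
      exact ⟨i₀, Fin.castSucc_injective _ h, rfl⟩
  · rintro ⟨i₀, rfl, rfl⟩
    exact insertMax_gapShift σ j i₀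

lemma card_filter_insertMax_last {n : ℕ} (σ : StWord n) (j : Fin (2 * n + 1)) :
    (univ.filter fun i => insertMax σ j i = Fin.last n).card = 2 := by
  rw [card_eq_two]
  refine ⟨⟨j.val, by omega⟩, ⟨j.val + 1, by omega⟩, by simp, ?_⟩
  ext i
  simp only [mem_filter, mem_univ, true_and, insertMax_eq_last_iff]
  simp [Fin.ext_iff]

lemma isStirling_insertMax_iff {n : ℕ} (σ : StWord n) (j : Fin (2 * n + 1)) :
    IsStirling (n + 1) (insertMax σ j) ↔ IsStirling n σ := by
  constructor
  · rintro ⟨h1, h2⟩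
    refine ⟨fun k => ?_, fun a b c hab hbc hac => ?_⟩
    · rw [← card_filter_insertMax_castSucc σ j]
      exact h1 _
    · have := h2 _ _ _ (gapShift_strictMono j hab) (gapShift_strictMono j hbc)
      simp only [insertMax_gapShift, Fin.castSucc_inj, Fin.castSucc_lt_castSucc_iff] at this
      exact this hac
  · rintro ⟨h1, h2⟩
    refine ⟨fun k => ?_, fun a b c hab hbc hac => ?_⟩
    · induction k using Fin.lastCases with
      | last => exact card_filter_insertMax_last σ j
      | cast k => rw [card_filter_insertMax_castSucc, h1]
    · by_cases hl : insertMax σ j a = Fin.last n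
      · have ha := (insertMax_eq_last_iff σ j a).1 hl
        have hc := (insertMax_eq_last_iff σ j c).1 (hac ▸ hl)
        rw [Fin.lt_def] at hab hbc
        omega
      · rcases gapShift_cases j a with h | ⟨a, rfl⟩
        · exact absurd ((insertMax_eq_last_iff σ j a).2 h) hl
        rcases gapShift_cases j c with h | ⟨c, rfl⟩
        · exact absurd (hac.trans ((insertMax_eq_last_iff σ j c).2 h)) hl
        rcases gapShift_cases j b with h | ⟨b, rfl⟩
        · rw [(insertMax_eq_last_iff σ j b).2 h]
          exact Fin.lt_last_iff_ne_last.2 hl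
        · rw [(gapShift_strictMono j).lt_iff_lt] at hab hbc
          simp only [insertMax_gapShift, Fin.castSucc_inj,
            Fin.castSucc_lt_castSucc_iff] at hac ⊢
          exact h2 a b c hab hbc hac

lemma insertMax_injective (n : ℕ) :
    Function.Injective fun p : StWord n × Fin (2 * n + 1) => insertMax p.1 p.2 := by
  rintro ⟨σ, j⟩ ⟨τ, j'⟩ h
  simp only at h
  have hj : j = j' := by
    have h1 : j.val = j'.val ∨ j.val = j'.val + 1 :=
      (insertMax_eq_last_iff τ j' ⟨j.val, by omega⟩).1
        (h ▸ (insertMax_eq_last_iff σ j _).2 (.inl rfl))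
    have h2 : j'.val = j.val ∨ j'.val = j.val + 1 :=
      (insertMax_eq_last_iff σ j ⟨j'.val, by omega⟩).1
        (h ▸ (insertMax_eq_last_iff τ j' _).2 (.inl rfl))
    omega
  subst hj
  refine Prod.ext (funext fun i => Fin.castSucc_injective _ ?_) rfl
  rw [← insertMax_gapShift σ j, ← insertMax_gapShift τ j, h]

lemma exists_eq_insertMax {n : ℕ} {τ : StWord (n + 1)} (hτ : IsStirling (n + 1) τ) :
    ∃ σ j, insertMax (n := n) σ j = τ := by
  obtain ⟨j, hj⟩ : ∃ j : Fin (2 * n + 1), ∀ i, τ i = Fin.last n ↔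
      i.val = j.val ∨ i.val = j.val + 1 := by
    obtain ⟨a, b, hab, hs⟩ : ∃ a b, a < b ∧ univ.filter (fun i => τ i = Fin.last n) = {a, b} := by
      obtain ⟨a, b, hne, hs⟩ := card_eq_two.1 (hτ.1 (Fin.last n))
      rcases hne.lt_or_gt with h | h
      · exact ⟨a, b, h, hs⟩
      · exact ⟨b, a, h, by rw [hs, pair_comm]⟩
    have hmem : ∀ i, τ i = Fin.last n ↔ i = a ∨ i = b := fun i => by
      simpa using Finset.ext_iff.1 hs i
    have hab' : b.val = a.val + 1 := by
      by_contra hne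
      rw [Fin.lt_def] at hab
      have := hτ.2 a ⟨a.val + 1, by omega⟩ b (by simp [Fin.lt_def])
        (by rw [Fin.lt_def]; simp only; omega)
        (by rw [(hmem a).2 (.inl rfl), (hmem b).2 (.inr rfl)])
      rw [(hmem a).2 (.inl rfl)] at this
      exact absurd this (Fin.le_last _).not_gt
    exact ⟨⟨a.val, by omega⟩, fun i => by rw [hmem, Fin.ext_iff, Fin.ext_iff, hab']⟩
  have hne : ∀ i, τ (gapShift j i) ≠ Fin.last n := by
    intro i
    rw [Ne, hj]
    simp only [gapShift]
    split_ifs <;> omega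
  refine ⟨fun i => (τ (gapShift j i)).castPred (hne i), j, funext fun i => ?_⟩
  rcases gapShift_cases j i with h | ⟨i, rfl⟩
  · rw [(hj i).2 h, insertMax_eq_last_iff]
    exact h
  · rw [insertMax_gapShift, Fin.castSucc_castPred]

lemma Mpoly_succ (n : ℕ) :
    Mpoly (n + 1) = ∑ σ ∈ univ.filter (fun σ : StWord n => IsStirling n σ),
      (C (2 * (ap n σ : ℝ) + 1) * X ^ ap n σ
        + C (2 * (n : ℝ) - 2 * (ap n σ : ℝ)) * X ^ (ap n σ + 1)) := by
  simp_rw [← sum_pow_ap_insertMax]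
  rw [← sum_product', Mpoly]
  symm
  refine sum_nbij (fun p => insertMax p.1 p.2) ?_ (insertMax_injective n).injOn ?_ fun _ _ => rfl
  · rintro ⟨σ, j⟩ h
    simpa [isStirling_insertMax_iff] using h
  · intro τ hτ
    have hτ : IsStirling (n + 1) τ := by simpa using hτ
    obtain ⟨σ, j, rfl⟩ := exists_eq_insertMax hτ
    exact ⟨(σ, j), by simpa using (isStirling_insertMax_iff σ j).1 hτ, rfl⟩

lemma coeff_Mpoly (n k : ℕ) :
    (Mpoly n).coeff k =
      ∑ σ ∈ univ.filter (fun σ : StWord n => IsStirling n σ), if k = ap n σ then 1 else 0 := by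
  simp [Mpoly, finsetSum_coeff, coeff_X_pow]

lemma coeff_Mpoly_succ_zero (n : ℕ) : (Mpoly (n + 1)).coeff 0 = (Mpoly n).coeff 0 := by
  rw [Mpoly_succ, coeff_Mpoly, finsetSum_coeff]
  refine sum_congr rfl fun σ _ => ?_
  simp only [coeff_add, coeff_C_mul, coeff_X_pow]
  rw [if_neg (by omega : ¬ 0 = ap n σ + 1)]
  split_ifs with h
  · simp [← h]
  · simp

lemma coeff_Mpoly_succ_succ (n k : ℕ) :
    (Mpoly (n + 1)).coeff (k + 1) =
      (2 * (k : ℝ) + 3) * (Mpoly n).coeff (k + 1)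
        + (2 * (n : ℝ) - 2 * (k : ℝ)) * (Mpoly n).coeff k := by
  rw [Mpoly_succ, coeff_Mpoly, coeff_Mpoly, finsetSum_coeff, mul_sum, mul_sum,
    ← sum_add_distrib]
  refine sum_congr rfl fun σ _ => ?_
  simp only [coeff_add, coeff_C_mul, coeff_X_pow, add_left_inj]
  split_ifs with h1 h2 h2
  · omega
  · rw [← h1]; push_cast; ring
  · rw [← h2]; ring
  · simp

lemma Mpoly_zero : Mpoly 0 = 1 := by
  have h : (univ.filter fun σ : StWord 0 => IsStirling 0 σ) = univ :=
    filter_true_of_mem fun σ _ => ⟨fun k => k.elim0, fun a => a.elim0⟩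
  have hap : ∀ σ, ap 0 σ = 0 := fun σ => by simp [ap]
  simp [Mpoly, h, hap]

/-- `o` and `e` are the coefficients of palindromic unimodal polynomials with centers of symmetry
`n / 2` and `(n + 1) / 2` respectively, both of degree at most `n`, the second one being divisible
by `X` and the first one not. -/
structure IsUnimodalPair (n : ℕ) (o e : ℕ → ℝ) : Prop where
  o_zero : 0 < o 0
  e_zero : e 0 = 0
  o_eq_zero : ∀ k, n < k → o k = 0
  e_eq_zero : ∀ k, n < k → e k = 0
  o_symm : ∀ i j, i + j = n → o i = o j
  e_symm : ∀ i j, i + j = n + 1 → e i = e j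
  o_mono : ∀ k, 2 * k + 1 ≤ n → o k ≤ o (k + 1)
  e_mono : ∀ k, 2 * k ≤ n → e k ≤ e (k + 1)

/-- The recurrence for the first part of the symmetric decomposition of `Mpoly`. -/
def nextO (n : ℕ) (o e : ℕ → ℝ) : ℕ → ℝ
  | 0 => o 0 + e 0
  | k + 1 => (2 * (k : ℝ) + 3) * o (k + 1) + (2 * (n : ℝ) + 1 - 2 * (k : ℝ)) * o k + e (k + 1)

/-- The recurrence for the second part of the symmetric decomposition of `Mpoly`. -/
def nextE (n : ℕ) (o e : ℕ → ℝ) : ℕ → ℝ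
  | 0 => 0
  | k + 1 => (2 * (k : ℝ) + 2) * e (k + 1) + (2 * (n : ℝ) + 2 - 2 * (k : ℝ)) * e k + o k

namespace IsUnimodalPair

variable {n : ℕ} {o e : ℕ → ℝ}

lemma nextO_symm (h : IsUnimodalPair n o e) (i j : ℕ) (hij : i + j = n + 1) :
    nextO n o e i = nextO n o e j := by
  rcases i with _ | i <;> rcases j with _ | j
  · rfl
  · obtain rfl : j = n := by omega
    simp only [nextO]
    rw [h.o_eq_zero (j + 1) (by omega), h.e_eq_zero (j + 1) (by omega), h.o_symm 0 j (by omega),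
      h.e_zero]
    ring
  · obtain rfl : i = n := by omega
    simp only [nextO]
    rw [h.o_eq_zero (i + 1) (by omega), h.e_eq_zero (i + 1) (by omega), h.o_symm 0 i (by omega),
      h.e_zero]
    ring
  · obtain rfl : n = i + j + 1 := by omega
    simp only [nextO]
    rw [h.o_symm (i + 1) j (by omega), h.o_symm i (j + 1) (by omega),
      h.e_symm (i + 1) (j + 1) (by omega)]
    push_cast
    ring

lemma nextE_symm (h : IsUnimodalPair n o e) (i j : ℕ) (hij : i + j = n + 2) :
    nextE n o e i = nextE n o e j := by
  rcases i with _ | i <;> rcases j with _ | j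
  · rfl
  · obtain rfl : j = n + 1 := by omega
    simp only [nextE]
    rw [h.e_eq_zero (n + 1 + 1) (by omega), h.e_eq_zero (n + 1) (by omega),
      h.o_eq_zero (n + 1) (by omega)]
    ring
  · obtain rfl : i = n + 1 := by omega
    simp only [nextE]
    rw [h.e_eq_zero (n + 1 + 1) (by omega), h.e_eq_zero (n + 1) (by omega),
      h.o_eq_zero (n + 1) (by omega)]
    ring
  · obtain rfl : n = i + j := by omega
    simp only [nextE]
    rw [h.e_symm (i + 1) j (by omega), h.e_symm i (j + 1) (by omega), h.o_symm i j rfl]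
    push_cast
    ring

lemma nextO_mono (h : IsUnimodalPair n o e) (k : ℕ) (hk : 2 * k ≤ n) :
    nextO n o e k ≤ nextO n o e (k + 1) := by
  rcases hk.eq_or_lt with hk' | hk'
  · exact (h.nextO_symm k (k + 1) (by omega)).le
  have ho := h.o_mono k (by omega)
  have he := h.e_mono k hk
  rcases k with _ | k
  · simp only [nextO]
    have h0 := h.o_zero
    have hn : (0 : ℝ) ≤ n := n.cast_nonneg
    push_cast
    nlinarith
  · simp only [nextO]
    have ho' := h.o_mono k (by omega)
    have hn : 2 * ((k : ℝ) + 1) ≤ n := by exact_mod_cast hk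
    have h1 := mul_nonneg (by positivity : (0 : ℝ) ≤ 2 * (k : ℝ) + 5) (sub_nonneg.2 ho)
    have h2 := mul_nonneg (by linarith [(k.cast_nonneg : (0 : ℝ) ≤ k)] :
      (0 : ℝ) ≤ 2 * (n : ℝ) + 1 - 2 * (k : ℝ)) (sub_nonneg.2 ho')
    push_cast
    linarith

lemma nextE_mono (h : IsUnimodalPair n o e) (k : ℕ) (hk : 2 * k ≤ n + 1) :
    nextE n o e k ≤ nextE n o e (k + 1) := by
  rcases hk.eq_or_lt with hk' | hk'
  · exact (h.nextE_symm k (k + 1) (by omega)).le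
  have he := h.e_mono k (by omega)
  rcases k with _ | k
  · simp only [nextE]
    have h0 := h.o_zero
    have h1 := h.e_zero
    push_cast
    rw [h1] at he ⊢
    linarith
  · simp only [nextE]
    have ho' := h.o_mono k (by omega)
    have he' := h.e_mono k (by omega)
    have hn : 2 * ((k : ℝ) + 1) ≤ n := by exact_mod_cast Nat.lt_succ_iff.1 hk'
    have h1 := mul_nonneg (by positivity : (0 : ℝ) ≤ 2 * (k : ℝ) + 4) (sub_nonneg.2 he)
    have h2 := mul_nonneg (by linarith [(k.cast_nonneg : (0 : ℝ) ≤ k)] :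
      (0 : ℝ) ≤ 2 * (n : ℝ) + 2 - 2 * (k : ℝ)) (sub_nonneg.2 he')
    push_cast
    linarith

lemma next (h : IsUnimodalPair n o e) :
    IsUnimodalPair (n + 1) (nextO n o e) (nextE n o e) where
  o_zero := by simpa [nextO, h.e_zero] using h.o_zero
  e_zero := rfl
  o_eq_zero k hk := by
    obtain ⟨k, rfl⟩ := Nat.exists_eq_succ_of_ne_zero (by omega : k ≠ 0)
    simp [nextO, h.o_eq_zero k (by omega), h.o_eq_zero (k + 1) (by omega),
      h.e_eq_zero (k + 1) (by omega)]
  e_eq_zero k hk := by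
    obtain ⟨k, rfl⟩ := Nat.exists_eq_succ_of_ne_zero (by omega : k ≠ 0)
    simp [nextE, h.o_eq_zero k (by omega), h.e_eq_zero (k + 1) (by omega),
      h.e_eq_zero k (by omega)]
  o_symm := h.nextO_symm
  e_symm := h.nextE_symm
  o_mono k hk := h.nextO_mono k (by omega)
  e_mono := h.nextE_mono

end IsUnimodalPair

/-- The coefficients of `Mpoly (n + 1)` are sums of two palindromic unimodal sequences whose
centers of symmetry differ by `1 / 2`. -/
lemma exists_isUnimodalPair (n : ℕ) :
    ∃ o e, IsUnimodalPair n o e ∧ ∀ k, (Mpoly (n + 1)).coeff k = o k + e k := by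
  induction n with
  | zero =>
    refine ⟨fun k => if k = 0 then 1 else 0, fun _ => 0, ?_, ?_⟩
    · constructor <;> intros <;> (try split_ifs) <;> first | rfl | omega | norm_num
    · rintro (_ | k)
      · simp [coeff_Mpoly_succ_zero, Mpoly_zero]
      · rw [coeff_Mpoly_succ_succ, Mpoly_zero, coeff_one, coeff_one]
        rcases k with _ | k <;> simp
  | succ n ih =>
    obtain ⟨o, e, h, hc⟩ := ih
    refine ⟨nextO n o e, nextE n o e, h.next, ?_⟩
    rintro (_ | k)
    · simp [coeff_Mpoly_succ_zero, hc, nextO, nextE]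
    · rw [coeff_Mpoly_succ_succ, hc, hc]
      simp only [nextO, nextE]
      push_cast
      ring

/-- For every `n ≥ 1`, `M_n(x)` has degree `n-1` and is alternatingly
increasing, i.e. its coefficients satisfy
`f_0 ≤ f_{n-1} ≤ f_1 ≤ f_{n-2} ≤ ⋯ ≤ f_{⌊n/2⌋}`; consequently `M_n(x)` is
unimodal with mode `⌊n/2⌋`. -/
theorem Mpoly_alternatingly_increasing (n : ℕ) (hn : 1 ≤ n) :
    (Mpoly n).natDegree = n - 1 ∧
    -- alternatingly increasing
    (∀ i, 2 * i ≤ n - 1 → (Mpoly n).coeff i ≤ (Mpoly n).coeff (n - 1 - i)) ∧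
    (∀ i, 2 * i + 1 ≤ n - 1 →
      (Mpoly n).coeff (n - 1 - i) ≤ (Mpoly n).coeff (i + 1)) ∧
    -- unimodal with mode ⌊n/2⌋
    (∀ i, i < n / 2 → (Mpoly n).coeff i ≤ (Mpoly n).coeff (i + 1)) ∧
    (∀ i, n / 2 ≤ i → i < n - 1 →
      (Mpoly n).coeff (i + 1) ≤ (Mpoly n).coeff i) := by
  obtain ⟨n, rfl⟩ := Nat.exists_eq_add_of_le' hn
  obtain ⟨o, e, h, hc⟩ := exists_isUnimodalPair n
  simp only [Nat.add_sub_cancel]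
  have hlow : ∀ i, 2 * i ≤ n → (Mpoly (n + 1)).coeff i ≤ (Mpoly (n + 1)).coeff (n - i) := by
    intro i hi
    rw [hc, hc, h.o_symm i (n - i) (by omega), h.e_symm (n - i) (i + 1) (by omega)]
    linarith [h.e_mono i hi]
  have hhigh : ∀ i, 2 * i + 1 ≤ n →
      (Mpoly (n + 1)).coeff (n - i) ≤ (Mpoly (n + 1)).coeff (i + 1) := by
    intro i hi
    rw [hc, hc, h.o_symm (n - i) i (by omega), h.e_symm (n - i) (i + 1) (by omega)]
    linarith [h.o_mono i hi]
  refine ⟨natDegree_eq_of_le_of_coeff_ne_zero ?_ ?_, hlow, hhigh, fun i hi => ?_,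
    fun i hi hi' => ?_⟩
  · refine natDegree_le_iff_coeff_eq_zero.2 fun k hk => ?_
    rw [hc, h.o_eq_zero k hk, h.e_eq_zero k hk, add_zero]
  · rw [hc, h.o_symm n 0 rfl, h.e_symm n 1 rfl]
    have h0 := h.e_mono 0 (by omega)
    rw [h.e_zero, zero_add] at h0
    exact (add_pos_of_pos_of_nonneg h.o_zero h0).ne'
  · exact (hlow i (by omega)).trans (hhigh i (by omega))
  · have h1 := hhigh (n - (i + 1)) (by omega)
    have h2 := hlow (n - i) (by omega)
    rw [show n - (n - (i + 1)) = i + 1 by omega, show n - (i + 1) + 1 = n - i by omega] at h1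
    rw [show n - (n - i) = i by omega] at h2
    exact h1.trans h2
end

section
/- For every n ≥ 1, the up-down run polynomial satisfies T_n(x) = T_n^E(x^2) + x·T_n^O(x^2), and the left peak polynomial satisfies W̄_n(x) = T_n^E(x) + T_n^O(x). -/
open Polynomial Finset

/-- The value `π(i)` of a permutation of `[n]` at position `i ∈ [n]`
(1-indexed), with the convention `π(0) = 0`. -/
def pval (n : ℕ) (π : Equiv.Perm (Fin n)) (i : ℕ) : ℤ :=
  if h : 1 ≤ i ∧ i ≤ n then ((π ⟨i - 1, by omega⟩ : Fin n).val + 1 : ℤ) else 0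

/-- The interior peak number
`ipk(π) = #{i ∈ [2, n-1] : π(i-1) < π(i) > π(i+1)}`. -/
def ipk (n : ℕ) (π : Equiv.Perm (Fin n)) : ℕ :=
  ((Finset.Icc 2 (n - 1)).filter
    (fun i => pval n π (i - 1) < pval n π i ∧ pval n π (i + 1) < pval n π i)).card

/-- The left peak number
`lpk(π) = #{i ∈ [n-1] : π(i-1) < π(i) > π(i+1)}` with `π(0) = 0`. -/
def lpk (n : ℕ) (π : Equiv.Perm (Fin n)) : ℕ :=
  ((Finset.Icc 1 (n - 1)).filter
    (fun i => pval n π (i - 1) < pval n π i ∧ pval n π (i + 1) < pval n π i)).card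

/-- The interior peak polynomial `W_n(x) = Σ_{π ∈ S_n} x^{ipk(π)}`. -/
noncomputable def Wpoly (n : ℕ) : Polynomial ℝ :=
  ∑ π : Equiv.Perm (Fin n), X ^ ipk n π

/-- The left peak polynomial `W̄_n(x) = Σ_{π ∈ S_n} x^{lpk(π)}`. -/
noncomputable def Wbarpoly (n : ℕ) : Polynomial ℝ :=
  ∑ π : Equiv.Perm (Fin n), X ^ lpk n π

/-- The number of up-down runs of `π`, i.e. the number of maximal monotone
consecutive blocks of the sequence `0, π(1), …, π(n)`.  Since consecutive
entries of this sequence are distinct, for `n ≥ 1` this number equals one plus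
the number of interior direction changes (peaks or valleys) of the sequence. -/
def udrun (n : ℕ) (π : Equiv.Perm (Fin n)) : ℕ :=
  if n = 0 then 0
  else
    1 + ((Finset.Icc 1 (n - 1)).filter
      (fun i =>
        (pval n π (i - 1) < pval n π i ∧ pval n π (i + 1) < pval n π i) ∨
        (pval n π i < pval n π (i - 1) ∧ pval n π i < pval n π (i + 1)))).card

/-- The up-down run polynomial `T_n(x) = Σ_{π ∈ S_n} x^{udrun(π)}`. -/
noncomputable def Tpoly (n : ℕ) : Polynomial ℝ :=
  ∑ π : Equiv.Perm (Fin n), X ^ udrun n π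

/-- `T_n^E(x) = Σ_{π ∈ S_n, π(n-1) > π(n)} x^{lpk(π)}` (with `π(0) = 0`). -/
noncomputable def TEpoly (n : ℕ) : Polynomial ℝ :=
  ∑ π ∈ Finset.univ.filter
      (fun π : Equiv.Perm (Fin n) => pval n π n < pval n π (n - 1)),
    X ^ lpk n π

/-- `T_n^O(x) = Σ_{π ∈ S_n, π(n-1) < π(n)} x^{lpk(π)}` (with `π(0) = 0`). -/
noncomputable def TOpoly (n : ℕ) : Polynomial ℝ :=
  ∑ π ∈ Finset.univ.filter
      (fun π : Equiv.Perm (Fin n) => pval n π (n - 1) < pval n π n),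
    X ^ lpk n π

/-- In a sequence that starts with an ascent and has no plateaus, peaks and valleys alternate,
so the number of turning points is determined by the number of peaks and the last step. -/
lemma one_add_card_turns_eq (a : ℕ → ℤ) (h0 : a 0 < a 1) (m : ℕ)
    (hne : ∀ i ≤ m, a i ≠ a (i + 1)) :
    1 + ((Finset.Icc 1 m).filter
      (fun i => (a (i - 1) < a i ∧ a (i + 1) < a i) ∨
        (a i < a (i - 1) ∧ a i < a (i + 1)))).card =
    2 * ((Finset.Icc 1 m).filter (fun i => a (i - 1) < a i ∧ a (i + 1) < a i)).card +
      if a m < a (m + 1) then 1 else 0 := by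
  induction m with
  | zero => simp [h0]
  | succ m ih =>
    have ih := ih fun i hi => hne i (by omega)
    have h1 := hne m (by omega)
    have h2 := hne (m + 1) le_rfl
    rw [← Finset.insert_Icc_right_eq_Icc_add_one (by omega : 1 ≤ m + 1),
      Finset.filter_insert, Finset.filter_insert]
    simp only [Nat.add_sub_cancel]
    rcases lt_or_gt_of_ne h1 with h1 | h1 <;> rcases lt_or_gt_of_ne h2 with h2 | h2 <;>
      simp [h1, h2, not_lt_of_gt] at ih ⊢ <;> omega

lemma pval_succ_ne (n : ℕ) (π : Equiv.Perm (Fin n)) (i : ℕ) (hi : i < n) :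
    pval n π i ≠ pval n π (i + 1) := by
  unfold pval
  rw [dif_pos (show 1 ≤ i + 1 ∧ i + 1 ≤ n by omega)]
  split_ifs with h
  · intro he
    have he : π ⟨i - 1, by omega⟩ = π ⟨i + 1 - 1, by omega⟩ := Fin.ext (by omega)
    have := congrArg Fin.val (π.injective he)
    simp only at this
    omega
  · omega

lemma udrun_eq (n : ℕ) (hn : 1 ≤ n) (π : Equiv.Perm (Fin n)) :
    udrun n π = 2 * lpk n π + if pval n π (n - 1) < pval n π n then 1 else 0 := by
  have h0 : pval n π 0 < pval n π 1 := by
    simp only [pval, dif_pos (show 1 ≤ 1 ∧ 1 ≤ n by omega)]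
    simp
  have h := one_add_card_turns_eq (pval n π) h0 (n - 1)
    fun i hi => pval_succ_ne n π i (by omega)
  rw [udrun, if_neg (by omega), h, lpk, Nat.sub_add_cancel hn]

/-- For every `n ≥ 1`, `T_n(x) = T_n^E(x²) + x·T_n^O(x²)` and
`W̄_n(x) = T_n^E(x) + T_n^O(x)`. -/
theorem Tpoly_HermiteBiehler_decomposition (n : ℕ) (hn : 1 ≤ n) :
    Tpoly n = (TEpoly n).comp (X ^ 2) + X * (TOpoly n).comp (X ^ 2) ∧
    Wbarpoly n = TEpoly n + TOpoly n := by
  have hfilter : Finset.univ.filter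
      (fun π : Equiv.Perm (Fin n) => ¬ pval n π (n - 1) < pval n π n) =
      Finset.univ.filter (fun π => pval n π n < pval n π (n - 1)) := by
    refine Finset.filter_congr fun π _ => ?_
    have h := pval_succ_ne n π (n - 1) (by omega)
    rw [Nat.sub_add_cancel hn] at h
    omega
  constructor
  · rw [Tpoly, ← Finset.sum_filter_not_add_sum_filter _
      (fun π => pval n π (n - 1) < pval n π n), hfilter, TEpoly, TOpoly,
      Polynomial.sum_comp, Polynomial.sum_comp, Finset.mul_sum]
    congr 1 <;> refine Finset.sum_congr rfl fun π hπ => ?_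
    all_goals have h := (Finset.mem_filter.mp hπ).2
    · rw [udrun_eq n hn, if_neg (not_lt_of_gt h), X_pow_comp, ← pow_mul, add_zero]
    · rw [udrun_eq n hn, if_pos h, X_pow_comp, ← pow_mul, pow_succ']
  · rw [Wbarpoly, ← Finset.sum_filter_not_add_sum_filter _
      (fun π => pval n π (n - 1) < pval n π n), hfilter, TEpoly, TOpoly]
end
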